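/- arXiv:2309.13870 — 3 statements merged into one kernel-verified Lean document; each statement's English description precedes it below -/
import Mathlib

section
/- Let σ be a partition and fix s ∈ I_σ; write s⁺ := s+(1,1) and t⁺ := t+(1,1). Then: (i) for every t ∈ I_σ^{<s}, s⁺ − t⁺ = h⁺_{σ∖s}(s∧t); (ii) for every t ∈ O_σ^{<s}, s⁺ − t = h⁺_{σ}(s∧t); (iii) for every t ∈ I_σ^{>s}, s⁺ − t⁺ = −h⁻_{σ∖s}(s∧t); (iv) for every t ∈ O_σ^{>s}, s⁺ − t = −h⁻_{σ}(s∧t). (All equalities are of vectors in ℤ².) -/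
/-!
Common setup: boxes, Young diagrams as finite lower sets of boxes (French notation),
arms, legs, hooks, the field `ℚ(α)`, rational functions in `u` over `ℚ(α)`,
the functions `T_Γ`, corners, star products, rectangles and complements.
-/

open scoped BigOperators

attribute [local instance] Classical.propDecidable

namespace JackLR

/-- A box `(x, y)`: `x` is the column index, `y` the row index (French notation). -/
abbrev Box := ℕ × ℕ

/-- The field `ℚ(α)`. -/
abbrev K := RatFunc ℚ

/-- Rational functions in a variable `u` with coefficients in `ℚ(α)`. -/
abbrev F := RatFunc K

/-- The indeterminate `α`. -/
noncomputable def alpha : K := RatFunc.X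

/-- `[c] := α·x − y` for `c = (x, y) ∈ ℤ²`. -/
noncomputable def brk (c : ℤ × ℤ) : K := alpha * (c.1 : K) - (c.2 : K)

/-- The embedding of a box into `ℤ²`. -/
def zb (b : Box) : ℤ × ℤ := ((b.1 : ℤ), (b.2 : ℤ))

/-- `[b]` for a box `b`. -/
noncomputable def brkN (b : Box) : K := brk (zb b)

/-- `S` is the set of boxes of a Young diagram (equivalently, of a partition). -/
def IsYoung (S : Finset Box) : Prop := IsLowerSet (↑S : Set Box)

/-- The arm of `s`: number of boxes of `S` strictly to the right of `s` in its row. -/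
def arm (S : Finset Box) (s : Box) : ℕ := (S.filter fun b => b.2 = s.2 ∧ s.1 < b.1).card

/-- The leg of `s`: number of boxes of `S` strictly above `s` in its column. -/
def leg (S : Finset Box) (s : Box) : ℕ := (S.filter fun b => b.1 = s.1 ∧ s.2 < b.2).card

/-- Upper hook vector `h⁺_S(s) = (arm+1, −leg)`. -/
def hup (S : Finset Box) (s : Box) : ℤ × ℤ := ((arm S s : ℤ) + 1, -(leg S s : ℤ))

/-- Lower hook vector `h⁻_S(s) = (arm, −leg−1)`. -/
def hlo (S : Finset Box) (s : Box) : ℤ × ℤ := ((arm S s : ℤ), -((leg S s : ℤ) + 1))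

/-- Upper hook value `uh_S(s) = α(arm+1) + leg`. -/
noncomputable def uh (S : Finset Box) (s : Box) : K := brk (hup S s)

/-- Lower hook value `lh_S(s) = α·arm + leg + 1`. -/
noncomputable def lh (S : Finset Box) (s : Box) : K := brk (hlo S s)

/-- The variable `u`. -/
noncomputable def uu : F := RatFunc.X

/-- `T_□(w) = (w−[0,0])(w−[1,1]) / ((w−[1,0])(w−[0,1]))`. -/
noncomputable def Tbox (w : F) : F :=
  ((w - RatFunc.C (brk (0, 0))) * (w - RatFunc.C (brk (1, 1)))) /
    ((w - RatFunc.C (brk (1, 0))) * (w - RatFunc.C (brk (0, 1))))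

/-- `T_Γ` with the variable `u` replaced by `w`. -/
noncomputable def TMat (Γ : Multiset Box) (w : F) : F :=
  (Γ.map fun b => Tbox (w - RatFunc.C (brkN b))).prod

/-- `T_Γ(u) = ∏_{b ∈ Γ} T_□(u − [b])` for a finite multiset `Γ` of boxes. -/
noncomputable def TM (Γ : Multiset Box) : F := TMat Γ uu

/-- `T_S(u)` for a finite set `S` of boxes. -/
noncomputable def TS (S : Finset Box) : F := TM S.val

/-- The star product `μ * ν` as the multiset `{s + t : s ∈ μ, t ∈ ν}` with multiplicity. -/
def star (μ ν : Finset Box) : Multiset Box :=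
  μ.val.bind fun s => ν.val.map fun t => (s.1 + t.1, s.2 + t.2)

/-- The rectangular partition `m^n` (n rows of length m). -/
def rect (m n : ℕ) : Finset Box := Finset.range m ×ˢ Finset.range n

/-- `v⁻ = (m−1, n−1)`. -/
def vminus (m n : ℕ) : Box := (m - 1, n - 1)

/-- `b̄ := v⁻ − b`. -/
def conjBox (m n : ℕ) (b : Box) : Box := (m - 1 - b.1, n - 1 - b.2)

/-- The complement partition of `μ ⊆ m^n` inside `m^n`, with boxes `{v⁻ − b : b ∈ m^n, b ∉ μ}`. -/
def complIn (m n : ℕ) (μ : Finset Box) : Finset Box := (rect m n \ μ).image (conjBox m n)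

/-- `b̂ := (m−1−b₁, b₂)`. -/
def hflip (m : ℕ) (b : Box) : Box := (m - 1 - b.1, b.2)

/-- `b̌ := (b₁, n−1−b₂)`. -/
def vflip (n : ℕ) (b : Box) : Box := (b.1, n - 1 - b.2)

/-- Inner corners `I_S`: removable boxes. -/
def Inner (S : Finset Box) : Finset Box :=
  S.filter fun s => (s.1 + 1, s.2) ∉ S ∧ (s.1, s.2 + 1) ∉ S

/-- `t` can be added to `S` to give again a Young diagram. -/
def addable (S : Finset Box) (t : Box) : Prop :=
  t ∉ S ∧ (t.1 = 0 ∨ (t.1 - 1, t.2) ∈ S) ∧ (t.2 = 0 ∨ (t.1, t.2 - 1) ∈ S)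

/-- Outer corners `O_S`: addable boxes (these all satisfy the bounds used below). -/
noncomputable def Outer (S : Finset Box) : Finset Box :=
  ((Finset.range (S.sup Prod.fst + 2)) ×ˢ (Finset.range (S.sup Prod.snd + 2))).filter
    fun t => addable S t

/-- `I⁺_S = {s + (1,1) : s ∈ I_S}`. -/
noncomputable def Iplus (S : Finset Box) : Finset Box :=
  (Inner S).image fun s => (s.1 + 1, s.2 + 1)

/-- `R^s_S` : boxes of `S` in the same row as `s`. -/
def rowOf (S : Finset Box) (s : Box) : Finset Box := S.filter fun b => b.2 = s.2

/-- `C^s_S` : boxes of `S` in the same column as `s`. -/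
def colOf (S : Finset Box) (s : Box) : Finset Box := S.filter fun b => b.1 = s.1

/-- `a ∧ b := (min a₁ b₁, min a₂ b₂)`. -/
def meet (a b : Box) : Box := (min a.1 b.1, min a.2 b.2)

/-- Pole order of `f` at `u = c`: multiplicity of `(u − c)` in the denominator minus its
multiplicity in the numerator, `f` being written in lowest terms. -/
noncomputable def polOrder (f : F) (c : K) : ℤ :=
  (f.denom.rootMultiplicity c : ℤ) - (f.num.rootMultiplicity c : ℤ)

/-- `ϖ_S = ∏_{b ∈ S, b ≠ (0,0)} [b]`. -/
noncomputable def varpi (S : Finset Box) : K := ∏ b ∈ S.erase (0, 0), brkN b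

theorem arm_eq_sub {S : Finset Box} {p : Box} {n : ℕ}
    (h : ∀ x, p.1 < x → ((x, p.2) ∈ S ↔ x < n)) : arm S p = n - p.1 - 1 := by
  have key : (S.filter fun b => b.2 = p.2 ∧ p.1 < b.1) =
      (Finset.Ioo p.1 n).image fun x => (x, p.2) := by
    ext ⟨x, y⟩
    simp only [Finset.mem_filter, Finset.mem_image, Finset.mem_Ioo, Prod.mk.injEq]
    constructor
    · rintro ⟨hS, rfl, hx⟩
      exact ⟨x, ⟨hx, (h x hx).1 hS⟩, rfl, rfl⟩
    · rintro ⟨x, ⟨hx, hn⟩, rfl, rfl⟩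
      exact ⟨(h x hx).2 hn, rfl, hx⟩
  rw [arm, key, Finset.card_image_of_injective _ (Prod.mk_left_injective _), Nat.card_Ioo]

theorem leg_eq_sub {S : Finset Box} {p : Box} {n : ℕ}
    (h : ∀ y, p.2 < y → ((p.1, y) ∈ S ↔ y < n)) : leg S p = n - p.2 - 1 := by
  have key : (S.filter fun b => b.1 = p.1 ∧ p.2 < b.2) =
      (Finset.Ioo p.2 n).image fun y => (p.1, y) := by
    ext ⟨x, y⟩
    simp only [Finset.mem_filter, Finset.mem_image, Finset.mem_Ioo, Prod.mk.injEq]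
    constructor
    · rintro ⟨hS, rfl, hy⟩
      exact ⟨y, ⟨hy, (h y hy).1 hS⟩, rfl, rfl⟩
    · rintro ⟨y, ⟨hy, hn⟩, rfl, rfl⟩
      exact ⟨(h y hy).2 hn, rfl, hy⟩
  rw [leg, key, Finset.card_image_of_injective _ (Prod.mk_right_injective _), Nat.card_Ioo]

theorem IsYoung.mem_of_le {S : Finset Box} (hS : IsYoung S) {a b c d : ℕ}
    (h : (c, d) ∈ S) (hac : a ≤ c) (hbd : b ≤ d) : (a, b) ∈ S :=
  hS (show ((a, b) : Box) ≤ (c, d) from ⟨hac, hbd⟩) h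

theorem IsYoung.mem_row_inner {S : Finset Box} (hS : IsYoung S) {s : Box} (hs : s ∈ Inner S)
    (x : ℕ) : (x, s.2) ∈ S ↔ x < s.1 + 1 := by
  obtain ⟨hm, hr, -⟩ := Finset.mem_filter.1 hs
  refine ⟨fun h => ?_, fun h => hS.mem_of_le hm (by omega) le_rfl⟩
  by_contra hx
  exact hr (hS.mem_of_le h (by omega) le_rfl)

theorem IsYoung.mem_col_inner {S : Finset Box} (hS : IsYoung S) {s : Box} (hs : s ∈ Inner S)
    (y : ℕ) : (s.1, y) ∈ S ↔ y < s.2 + 1 := by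
  obtain ⟨hm, -, hr⟩ := Finset.mem_filter.1 hs
  refine ⟨fun h => ?_, fun h => hS.mem_of_le hm le_rfl (by omega)⟩
  by_contra hy
  exact hr (hS.mem_of_le h le_rfl (by omega))

theorem IsYoung.mem_row_addable {S : Finset Box} (hS : IsYoung S) {t : Box} (ht : addable S t)
    (x : ℕ) : (x, t.2) ∈ S ↔ x < t.1 := by
  obtain ⟨hm, hr, -⟩ := ht
  refine ⟨fun h => ?_, fun h => ?_⟩
  · by_contra hx
    exact hm (hS.mem_of_le h (by omega) le_rfl)
  · exact hS.mem_of_le (hr.resolve_left (by omega)) (by omega) le_rfl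

theorem IsYoung.mem_col_addable {S : Finset Box} (hS : IsYoung S) {t : Box} (ht : addable S t)
    (y : ℕ) : (t.1, y) ∈ S ↔ y < t.2 := by
  obtain ⟨hm, -, hr⟩ := ht
  refine ⟨fun h => ?_, fun h => ?_⟩
  · by_contra hy
    exact hm (hS.mem_of_le h le_rfl (by omega))
  · exact hS.mem_of_le (hr.resolve_left (by omega)) le_rfl (by omega)

/-- Differences of corners of `σ` (relative to a fixed inner corner `s`)
are hook vectors. -/
theorem stmt7 (σ : Finset Box) (hσ : IsYoung σ) (s : Box) (hs : s ∈ Inner σ) :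
    (∀ t ∈ Inner σ, t.1 < s.1 →
      zb (s.1 + 1, s.2 + 1) - zb (t.1 + 1, t.2 + 1) = hup (σ.erase s) (meet s t)) ∧
    (∀ t, addable σ t → t.1 < s.1 →
      zb (s.1 + 1, s.2 + 1) - zb t = hup σ (meet s t)) ∧
    (∀ t ∈ Inner σ, s.1 < t.1 →
      zb (s.1 + 1, s.2 + 1) - zb (t.1 + 1, t.2 + 1) = -hlo (σ.erase s) (meet s t)) ∧
    (∀ t, addable σ t → s.1 < t.1 →
      zb (s.1 + 1, s.2 + 1) - zb t = -hlo σ (meet s t)) := by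
  have hrow := hσ.mem_row_inner hs
  have hcol := hσ.mem_col_inner hs
  obtain ⟨a, b⟩ := s
  dsimp only at hrow hcol
  refine ⟨?_, ?_, ?_, ?_⟩ <;> rintro ⟨c, d⟩ ht hlt <;> dsimp only at hlt
  · have trow := hσ.mem_row_inner ht
    have tcol := hσ.mem_col_inner ht
    dsimp only at trow tcol
    have hbd : b < d := by
      by_contra hdb
      have h1 := (trow (c + 1)).not.2 (by omega)
      exact h1 (hσ.mem_of_le ((hrow a).2 (by omega)) hlt (by omega))
    have hmeet : meet (a, b) (c, d) = (c, b) := by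
      simp only [meet, Prod.mk.injEq]; omega
    have harm : arm (σ.erase (a, b)) (c, b) = a - c - 1 := arm_eq_sub fun x _ => by
      simp only [Finset.mem_erase, hrow, ne_eq, Prod.mk.injEq, and_true]; omega
    have hleg : leg (σ.erase (a, b)) (c, b) = d + 1 - b - 1 := leg_eq_sub fun y _ => by
      simp only [Finset.mem_erase, tcol, ne_eq, Prod.mk.injEq]; omega
    simp only [hmeet, hup, zb, harm, hleg, Prod.mk_sub_mk, Prod.mk.injEq]
    omega
  · have tcol := hσ.mem_col_addable ht
    dsimp only at tcol
    have hbd : b < d := (tcol b).1 ((hrow c).2 (by omega))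
    have hmeet : meet (a, b) (c, d) = (c, b) := by
      simp only [meet, Prod.mk.injEq]; omega
    have harm : arm σ (c, b) = a + 1 - c - 1 := arm_eq_sub fun x _ => hrow x
    have hleg : leg σ (c, b) = d - b - 1 := leg_eq_sub fun y _ => tcol y
    simp only [hmeet, hup, zb, harm, hleg, Prod.mk_sub_mk, Prod.mk.injEq]
    omega
  · have trow := hσ.mem_row_inner ht
    have tcol := hσ.mem_col_inner ht
    dsimp only at trow tcol
    have hdb : d < b := by
      by_contra hbd
      have h1 := (hrow (a + 1)).not.2 (by omega)
      exact h1 (hσ.mem_of_le ((trow c).2 (by omega)) hlt (by omega))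
    have hmeet : meet (a, b) (c, d) = (a, d) := by
      simp only [meet, Prod.mk.injEq]; omega
    have harm : arm (σ.erase (a, b)) (a, d) = c + 1 - a - 1 := arm_eq_sub fun x _ => by
      simp only [Finset.mem_erase, trow, ne_eq, Prod.mk.injEq]; omega
    have hleg : leg (σ.erase (a, b)) (a, d) = b - d - 1 := leg_eq_sub fun y _ => by
      simp only [Finset.mem_erase, hcol, ne_eq, Prod.mk.injEq, true_and]; omega
    simp only [hmeet, hlo, zb, harm, hleg, Prod.mk_sub_mk, Prod.neg_mk, Prod.mk.injEq]
    omega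
  · have trow := hσ.mem_row_addable ht
    dsimp only at trow
    have hdb : d < b + 1 := (hcol d).1 ((trow a).2 hlt)
    have hmeet : meet (a, b) (c, d) = (a, d) := by
      simp only [meet, Prod.mk.injEq]; omega
    have harm : arm σ (a, d) = c - a - 1 := arm_eq_sub fun x _ => trow x
    have hleg : leg σ (a, d) = b + 1 - d - 1 := leg_eq_sub fun y _ => hcol y
    simp only [hmeet, hlo, zb, harm, hleg, Prod.mk_sub_mk, Prod.neg_mk, Prod.mk.injEq]
    omega

end JackLR
end

section
/- Let μ, ν be partitions with ν nonempty, and let s = (s₁,s₂) ∈ ℤ² with s₁ ≥ 1, s₂ ≥ 1 be such that s⁻ := s−(1,1) is not a box of μ. For a box a with a₁ ≤ s₁−1 and a₂ ≤ s₂−1, let Rect(a,s) := {c ∈ ℕ² : a₁ ≤ c₁ ≤ s₁−1, a₂ ≤ c₂ ≤ s₂−1}, let Rect(s) := Rect((0,0),s), let λ^R := ∪_{t ∈ O_μ ∩ Rect(s)} Rect(t,s) (the shape between μ and s), and let λ := {s⁻ − c : c ∈ λ^R}, which is a Young diagram. Then [s⁻] is a simple pole of T_{μ*ν}(u) if and only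 if s⁻ ∉ ν and λ ⊆ ν. -/
/-!
Common setup: boxes, Young diagrams as finite lower sets of boxes (French notation),
arms, legs, hooks, the field `ℚ(α)`, rational functions in `u` over `ℚ(α)`,
the functions `T_Γ`, corners, star products, rectangles and complements.
-/

open scoped BigOperators

attribute [local instance] Classical.propDecidable

namespace JackLR

lemma brk_injective : Function.Injective brk := by
  rintro ⟨a, b⟩ ⟨c, d⟩ h
  have hp : (Polynomial.C (a : ℚ) * Polynomial.X - Polynomial.C (b : ℚ)) =
      (Polynomial.C (c : ℚ) * Polynomial.X - Polynomial.C (d : ℚ)) := by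
    apply RatFunc.algebraMap_injective ℚ
    simpa [brk, alpha, mul_comm] using h
  obtain rfl : b = d := by simpa using congrArg (Polynomial.coeff · 0) hp
  obtain rfl : a = c := by simpa using congrArg (Polynomial.coeff · 1) hp
  rfl

lemma brk_add (c d : ℤ × ℤ) : brk c + brk d = brk (c + d) := by
  simp only [brk, Prod.fst_add, Prod.snd_add, Int.cast_add]
  ring

/-- The pole order can be read off from any fraction representing the rational function. -/
lemma polOrder_div {a b : Polynomial K} (ha : a ≠ 0) (hb : b ≠ 0) (c : K) :
    polOrder (algebraMap (Polynomial K) F a / algebraMap (Polynomial K) F b) c =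
      b.rootMultiplicity c - a.rootMultiplicity c := by
  set f : F := algebraMap (Polynomial K) F a / algebraMap (Polynomial K) F b with hf
  have hb' : algebraMap (Polynomial K) F b ≠ 0 := by simpa using hb
  have hf0 : f ≠ 0 := div_ne_zero (by simpa using ha) hb'
  have hd' : algebraMap (Polynomial K) F f.denom ≠ 0 := by simpa using f.denom_ne_zero
  have key : f.num * b = a * f.denom := by
    apply RatFunc.algebraMap_injective K
    rw [map_mul, map_mul, ← div_eq_div_iff hd' hb', RatFunc.num_div_denom]
  have hm := congrArg (Polynomial.rootMultiplicity c) key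
  rw [Polynomial.rootMultiplicity_mul (mul_ne_zero (RatFunc.num_ne_zero hf0) hb),
    Polynomial.rootMultiplicity_mul (mul_ne_zero ha f.denom_ne_zero)] at hm
  unfold polOrder
  omega

lemma polOrder_mul {f g : F} (hf : f ≠ 0) (hg : g ≠ 0) (c : K) :
    polOrder (f * g) c = polOrder f c + polOrder g c := by
  have hfn := RatFunc.num_ne_zero hf
  have hgn := RatFunc.num_ne_zero hg
  have h : f * g = algebraMap (Polynomial K) F (f.num * g.num) /
      algebraMap (Polynomial K) F (f.denom * g.denom) := by
    rw [map_mul, map_mul, mul_div_mul_comm, RatFunc.num_div_denom, RatFunc.num_div_denom]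
  have hn := mul_ne_zero hfn hgn
  have hd := mul_ne_zero f.denom_ne_zero g.denom_ne_zero
  rw [h, polOrder_div hn hd, Polynomial.rootMultiplicity_mul hn,
    Polynomial.rootMultiplicity_mul hd]
  simp only [polOrder]
  push_cast
  ring

lemma polOrder_one (c : K) : polOrder 1 c = 0 := by
  simp [polOrder]

lemma polOrder_multiset_prod (Γ : Multiset F) (h : ∀ f ∈ Γ, f ≠ 0) (c : K) :
    polOrder Γ.prod c = (Γ.map fun f => polOrder f c).sum := by
  induction Γ using Multiset.induction_on with
  | empty => simp [polOrder_one]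
  | cons f Γ ih =>
    have hΓ : ∀ g ∈ Γ, g ≠ 0 := fun g hg => h g (Multiset.mem_cons_of_mem hg)
    rw [Multiset.prod_cons, polOrder_mul (h f (Multiset.mem_cons_self f Γ))
      (Multiset.prod_ne_zero fun h0 => hΓ 0 h0 rfl), ih hΓ, Multiset.map_cons, Multiset.sum_cons]

lemma Tbox_shift (b : ℤ × ℤ) :
    Tbox (uu - RatFunc.C (brk b)) =
      algebraMap (Polynomial K) F ((Polynomial.X - Polynomial.C (brk b)) *
        (Polynomial.X - Polynomial.C (brk (b + (1, 1))))) /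
      algebraMap (Polynomial K) F ((Polynomial.X - Polynomial.C (brk (b + (1, 0)))) *
        (Polynomial.X - Polynomial.C (brk (b + (0, 1))))) := by
  have h0 : brk (0, 0) = 0 := by simp [brk]
  simp only [Tbox, uu, ← brk_add, h0, map_mul, map_sub, map_add, RatFunc.algebraMap_X,
    RatFunc.algebraMap_C, map_zero, sub_zero, sub_sub]

lemma X_sub_C_mul_ne_zero (a b : K) :
    (Polynomial.X - Polynomial.C a) * (Polynomial.X - Polynomial.C b) ≠ 0 :=
  mul_ne_zero (Polynomial.X_sub_C_ne_zero a) (Polynomial.X_sub_C_ne_zero b)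

lemma Tbox_shift_ne_zero (b : ℤ × ℤ) : Tbox (uu - RatFunc.C (brk b)) ≠ 0 := by
  rw [Tbox_shift]
  refine div_ne_zero ?_ ?_ <;>
    exact (RatFunc.algebraMap_ne_zero (X_sub_C_mul_ne_zero _ _))

lemma polOrder_Tbox_shift (b c : ℤ × ℤ) :
    polOrder (Tbox (uu - RatFunc.C (brk b))) (brk c) =
      (if c = b + (1, 0) then 1 else 0) + (if c = b + (0, 1) then 1 else 0)
        - (if c = b then 1 else 0) - (if c = b + (1, 1) then 1 else 0) := by
  rw [Tbox_shift, polOrder_div (X_sub_C_mul_ne_zero _ _) (X_sub_C_mul_ne_zero _ _),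
    Polynomial.rootMultiplicity_mul (X_sub_C_mul_ne_zero _ _),
    Polynomial.rootMultiplicity_mul (X_sub_C_mul_ne_zero _ _)]
  simp only [Polynomial.rootMultiplicity_X_sub_C, brk_injective.eq_iff]
  push_cast
  ring

/-- The indicator function of a set of boxes, extended by zero to `ℤ²`. -/
noncomputable def indicator (S : Finset Box) (x y : ℤ) : ℤ :=
  ∑ t ∈ S, if (x, y) = zb t then 1 else 0

lemma indicator_natCast (S : Finset Box) (x y : ℕ) :
    indicator S x y = if (x, y) ∈ S then 1 else 0 := by
  have h : ∀ t : Box, ((x : ℤ), (y : ℤ)) = zb t ↔ (x, y) = t := by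
    rintro ⟨a, b⟩
    simp [zb]
  simp only [indicator, h, Finset.sum_ite_eq]

lemma indicator_of_neg (S : Finset Box) {x y : ℤ} (h : x < 0 ∨ y < 0) : indicator S x y = 0 := by
  refine Finset.sum_eq_zero fun t _ => if_neg fun ht => ?_
  simp only [zb, Prod.mk.injEq] at ht
  omega

lemma polOrder_TM_star (μ ν : Finset Box) (x y : ℤ) :
    polOrder (TM (star μ ν)) (brk (x, y)) =
      ∑ r ∈ ν, (indicator μ (x - r.1 - 1) (y - r.2) + indicator μ (x - r.1) (y - r.2 - 1)
        - indicator μ (x - r.1) (y - r.2) - indicator μ (x - r.1 - 1) (y - r.2 - 1)) := by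
  have hne : ∀ f ∈ (star μ ν).map fun b => Tbox (uu - RatFunc.C (brkN b)), f ≠ 0 := by
    intro f hf
    obtain ⟨b, -, rfl⟩ := Multiset.mem_map.1 hf
    exact Tbox_shift_ne_zero _
  have hsum : polOrder (TM (star μ ν)) (brk (x, y)) = ∑ t ∈ μ, ∑ r ∈ ν,
      polOrder (Tbox (uu - RatFunc.C (brkN (t.1 + r.1, t.2 + r.2)))) (brk (x, y)) := by
    rw [TM, TMat, polOrder_multiset_prod _ hne]
    simp only [star, Multiset.map_bind, Multiset.map_map, Multiset.sum_bind, Function.comp_def]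
    rfl
  rw [hsum, Finset.sum_comm]
  refine Finset.sum_congr rfl fun r _ => ?_
  simp only [indicator, ← Finset.sum_add_distrib, ← Finset.sum_sub_distrib]
  refine Finset.sum_congr rfl fun t _ => ?_
  rw [brkN, polOrder_Tbox_shift]
  simp only [zb, Prod.mk_add_mk, Prod.mk.injEq]
  push_cast
  congr 1
  · congr 1
    · congr 1
      · exact if_congr (by omega) rfl rfl
      · exact if_congr (by omega) rfl rfl
    · exact if_congr (by omega) rfl rfl
  · exact if_congr (by omega) rfl rfl

/-- Summation over a Young diagram, row by row. -/
lemma sum_eq_sum_range_colLen (Y : YoungDiagram) {n : ℕ} (hn : Y.rowLen 0 ≤ n) (f : ℕ → ℕ → ℤ) :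
    ∑ r ∈ Y.cells, f r.1 r.2 = ∑ j ∈ Finset.range n, ∑ i ∈ Finset.range (Y.colLen j), f i j := by
  rw [Finset.sum_sigma']
  refine Finset.sum_bij' (fun r _ => ⟨r.2, r.1⟩) (fun q _ => (q.2, q.1)) ?_ ?_ ?_ ?_ ?_
  · rintro ⟨i, j⟩ h
    have hij : (i, j) ∈ Y := h
    have h0 : j < Y.rowLen 0 := (YoungDiagram.mem_iff_lt_rowLen.1 hij).trans_le
      (Y.rowLen_anti 0 i (Nat.zero_le i))
    simpa [← YoungDiagram.mem_iff_lt_colLen, hij] using h0.trans_le hn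
  · rintro ⟨j, i⟩ h
    simpa [← YoungDiagram.mem_iff_lt_colLen] using (Finset.mem_sigma.1 h).2
  · intros; rfl
  · intros; rfl
  · intros; rfl

/-- The pole order as an alternating count along the boundary of `ν`. -/
lemma polOrder_TM_star_eq_sum (μ : Finset Box) (Y : YoungDiagram) (p : Box) (hp : p ∉ μ) :
    polOrder (TM (star μ Y.cells)) (brkN p) =
      indicator μ (p.1 - Y.colLen p.2) 0 -
        ∑ j ∈ Finset.range p.2, (indicator μ (p.1 - Y.colLen j) (p.2 - j - 1) -
          indicator μ (p.1 - Y.colLen j) (p.2 - j)) := by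
  set n := p.2 + 1 + Y.rowLen 0 with hn
  set h : ℕ → ℕ → ℤ := fun i j =>
    indicator μ (p.1 - i) (p.2 - j - 1) - indicator μ (p.1 - i) (p.2 - j) with hh
  have hrow : ∀ j, ∑ i ∈ Finset.range (Y.colLen j),
      (indicator μ (p.1 - i - 1) (p.2 - j) + indicator μ (p.1 - i) (p.2 - j - 1)
        - indicator μ (p.1 - i) (p.2 - j) - indicator μ (p.1 - i - 1) (p.2 - j - 1)) =
      h 0 j - h (Y.colLen j) j := by
    intro j
    rw [← Finset.sum_range_sub' fun i => h i j]
    refine Finset.sum_congr rfl fun i _ => ?_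
    simp only [hh, Nat.cast_add, Nat.cast_one, ← sub_sub]
    ring
  have hcol : ∑ j ∈ Finset.range n, h 0 j = 0 := by
    have h1 : ∀ j ∈ Finset.range n, h 0 j =
        (fun j : ℕ => indicator μ p.1 (p.2 - j)) (j + 1) -
        (fun j : ℕ => indicator μ p.1 (p.2 - j)) j := by
      intro j _
      simp [hh, ← sub_sub]
    rw [Finset.sum_congr rfl h1,
      Finset.sum_range_sub fun j : ℕ => indicator μ p.1 (p.2 - j)]
    have h2 := indicator_natCast μ p.1 p.2
    rw [if_neg hp] at h2
    simp only [Nat.cast_zero, sub_zero, h2]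
    exact indicator_of_neg μ (Or.inr (by omega))
  have htail : ∑ j ∈ Finset.range n, h (Y.colLen j) j =
      ∑ j ∈ Finset.range (p.2 + 1), h (Y.colLen j) j := by
    refine (Finset.sum_subset (Finset.range_mono (by omega)) fun j _ hj => ?_).symm
    simp only [Finset.mem_range, not_lt] at hj
    simp only [hh]
    rw [indicator_of_neg μ (Or.inr (by omega)), indicator_of_neg μ (Or.inr (by omega)), sub_zero]
  have hlast : h (Y.colLen p.2) p.2 = - indicator μ (p.1 - Y.colLen p.2) 0 := by
    simp only [hh, sub_self]
    rw [indicator_of_neg μ (Or.inr (by omega)), zero_sub]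
  rw [brkN, zb, polOrder_TM_star, sum_eq_sum_range_colLen Y (n := n) (by omega)
    (fun i j => indicator μ (p.1 - i - 1) (p.2 - j) + indicator μ (p.1 - i) (p.2 - j - 1)
        - indicator μ (p.1 - i) (p.2 - j) - indicator μ (p.1 - i - 1) (p.2 - j - 1)),
    Finset.sum_congr rfl fun j _ => hrow j, Finset.sum_sub_distrib, hcol, htail,
    Finset.sum_range_succ, hlast]
  ring

lemma indicator_nonneg (S : Finset Box) (x y : ℤ) : 0 ≤ indicator S x y :=
  Finset.sum_nonneg fun _ _ => by split_ifs <;> simp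

lemma indicator_eq_one_iff (S : Finset Box) (x : ℤ) (y : ℕ) :
    indicator S x y = 1 ↔ 0 ≤ x ∧ (x.toNat, y) ∈ S := by
  obtain hx | hx := lt_or_ge x 0
  · simp [indicator_of_neg S (Or.inl hx), hx]
  · lift x to ℕ using hx
    simp [indicator_natCast]

lemma indicator_le_one (S : Finset Box) (x : ℤ) (y : ℕ) : indicator S x y ≤ 1 := by
  obtain hx | hx := lt_or_ge x 0
  · simp [indicator_of_neg S (Or.inl hx)]
  · lift x to ℕ using hx
    rw [indicator_natCast]
    split_ifs <;> simp

lemma indicator_succ_le {S : Finset Box} (hS : IsYoung S) (x : ℤ) (y : ℕ) :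
    indicator S x (y + 1 : ℕ) ≤ indicator S x y := by
  obtain hx | hx := lt_or_ge x 0
  · simp [indicator_of_neg S (Or.inl hx)]
  · lift x to ℕ using hx
    rw [indicator_natCast, indicator_natCast]
    have : (x, y + 1) ∈ S → (x, y) ∈ S := fun h => hS (show (x, y) ≤ (x, y + 1) by simp) h
    split_ifs <;> simp_all

/-- Simple poles in terms of the boxes outside `μ`. -/
lemma polOrder_eq_one_iff (μ : Finset Box) (hμ : IsYoung μ) (Y : YoungDiagram) (p : Box)
    (hp : p ∉ μ) :
    polOrder (TM (star μ Y.cells)) (brkN p) = 1 ↔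
      p ∉ Y ∧ ∀ q ≤ p, q ∉ μ → (p.1 - q.1, p.2 - q.2) ∈ Y := by
  obtain ⟨a, b⟩ := p
  rw [polOrder_TM_star_eq_sum μ Y _ hp]
  have hcast : ∀ j ∈ Finset.range b, ((b : ℤ) - j - 1 = (b - j - 1 : ℕ)) ∧
      ((b : ℤ) - j = ((b - j - 1) + 1 : ℕ)) := by
    intro j hj
    have := Finset.mem_range.1 hj
    omega
  have hterm : ∀ j ∈ Finset.range b, 0 ≤ indicator μ (a - Y.colLen j) (b - j - 1) -
      indicator μ (a - Y.colLen j) (b - j) := by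
    intro j hj
    rw [(hcast j hj).1, (hcast j hj).2]
    exact sub_nonneg.2 (indicator_succ_le hμ _ _)
  have hsum := Finset.sum_nonneg hterm
  have h0 : indicator μ (a - Y.colLen b) 0 = 1 ↔ _ := indicator_eq_one_iff μ (a - Y.colLen b) 0
  have h0le : indicator μ (a - Y.colLen b) 0 ≤ 1 := indicator_le_one μ (a - Y.colLen b) 0
  constructor
  · intro h
    dsimp only at h
    have hz := (Finset.sum_eq_zero_iff_of_nonneg hterm).1 (by omega)
    obtain ⟨hab, hbase⟩ := h0.1 (by omega)
    refine ⟨by rw [YoungDiagram.mem_iff_lt_colLen]; omega, ?_⟩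
    have hmem : ∀ y ≤ b, Y.colLen (b - y) ≤ a → (a - Y.colLen (b - y), y) ∈ μ := by
      intro y
      induction y with
      | zero =>
        intro _ _
        convert hbase using 2
        simp only [tsub_zero]
        omega
      | succ y ih =>
        intro hy hle
        have hanti := Y.colLen_anti (b - (y + 1)) (b - y) (by omega)
        have hprev : (a - Y.colLen (b - (y + 1)), y) ∈ μ :=
          hμ (Prod.mk_le_mk.2 ⟨by omega, le_rfl⟩) (ih (by omega) (by omega))
        have hj := hz (b - (y + 1)) (by simp; omega)
        rw [show (b : ℤ) - (b - (y + 1) : ℕ) - 1 = (y : ℕ) by omega,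
          show (b : ℤ) - (b - (y + 1) : ℕ) = (y + 1 : ℕ) by omega,
          (indicator_eq_one_iff μ _ y).2 ⟨by omega, by convert hprev using 2; omega⟩] at hj
        have := ((indicator_eq_one_iff μ _ (y + 1)).1 (sub_eq_zero.1 hj).symm).2
        convert this using 2
        omega
    rintro ⟨x, y⟩ hq hqμ
    obtain ⟨hxa, hyb⟩ := Prod.mk_le_mk.1 hq
    by_contra hY
    rw [YoungDiagram.mem_iff_lt_colLen] at hY
    dsimp only at hY
    exact hqμ (hμ (Prod.mk_le_mk.2 ⟨by omega, le_rfl⟩) (hmem y hyb (by omega)))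
  · rintro ⟨hpY, hall⟩
    have hmem : ∀ y ≤ b, Y.colLen (b - y) ≤ a → (a - Y.colLen (b - y), y) ∈ μ := by
      intro y hy hle
      by_contra hq
      have := hall _ (Prod.mk_le_mk.2 ⟨Nat.sub_le _ _, hy⟩) hq
      rw [YoungDiagram.mem_iff_lt_colLen] at this
      dsimp only at this
      omega
    rw [YoungDiagram.mem_iff_lt_colLen] at hpY
    dsimp only
    rw [h0.2 ⟨by omega, by convert hmem 0 (Nat.zero_le b) (by simpa using hpY) using 2; simp⟩,
      Finset.sum_eq_zero, sub_zero]
    intro j hj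
    refine le_antisymm ?_ (hterm j hj)
    obtain hlt | hle := lt_or_ge a (Y.colLen j)
    · rw [indicator_of_neg μ (Or.inl (by omega)), indicator_of_neg μ (Or.inl (by omega)), sub_zero]
    · have hjb := Finset.mem_range.1 hj
      have hm := hmem (b - j) (by omega) (by rwa [Nat.sub_sub_self hjb.le])
      rw [Nat.sub_sub_self hjb.le] at hm
      rw [(hcast j hj).1, show (b : ℤ) - j = (b - j : ℕ) by omega,
        (indicator_eq_one_iff μ _ (b - j)).2 ⟨by omega, by convert hm using 2; omega⟩]
      exact sub_nonpos.2 (indicator_le_one _ _ _)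

lemma mem_Outer_iff (S : Finset Box) (t : Box) : t ∈ Outer S ↔ addable S t := by
  simp only [Outer, Finset.mem_filter, Finset.mem_product, Finset.mem_range, and_iff_right_iff_imp]
  rintro ⟨-, h1, h2⟩
  constructor
  · rcases h1 with h | h
    · omega
    · have := Finset.le_sup (f := Prod.fst) h
      dsimp only at this
      omega
  · rcases h2 with h | h
    · omega
    · have := Finset.le_sup (f := Prod.snd) h
      dsimp only at this
      omega

/-- Every box outside a Young diagram lies weakly above an outer corner. -/
lemma exists_Outer_le (S : Finset Box) (q : Box) (hq : q ∉ S) : ∃ t ∈ Outer S, t ≤ q := by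
  obtain ⟨t, htq, ht⟩ := exists_minimal_le_of_wellFoundedLT (fun t : Box => t ∉ S) q hq
  refine ⟨t, (mem_Outer_iff S t).2 ⟨ht.prop, ?_, ?_⟩, htq⟩
  · by_contra! h
    have := (Prod.le_def.1 (ht.le_of_le h.2 (Prod.mk_le_mk.2 ⟨Nat.sub_le _ _, le_rfl⟩))).1
    dsimp only at this
    omega
  · by_contra! h
    have := (Prod.le_def.1 (ht.le_of_le h.2 (Prod.mk_le_mk.2 ⟨le_rfl, Nat.sub_le _ _⟩))).2
    dsimp only at this
    omega

/-- The boxes between `μ` and `p` are those weakly below `p` and outside `μ`. -/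
lemma mem_biUnion_Outer_iff (μ : Finset Box) (hμ : IsYoung μ) (p q : Box) :
    q ∈ ((Outer μ ∩ Finset.Icc (0, 0) p).biUnion fun t => Finset.Icc t p) ↔ q ≤ p ∧ q ∉ μ := by
  simp only [Finset.mem_biUnion, Finset.mem_inter, Finset.mem_Icc]
  constructor
  · rintro ⟨t, ⟨ht, -⟩, htq, hqp⟩
    exact ⟨hqp, fun h => ((mem_Outer_iff μ t).1 ht).1 (hμ htq h)⟩
  · rintro ⟨hqp, hq⟩
    obtain ⟨t, ht, htq⟩ := exists_Outer_le μ q hq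
    exact ⟨t, ⟨ht, Prod.mk_le_mk.2 ⟨Nat.zero_le _, Nat.zero_le _⟩, htq.trans hqp⟩, htq, hqp⟩

/-- Characterization of the simple poles of `T_{μ*ν}`:
`[s⁻]` is a simple pole iff `s⁻ ∉ ν` and the shape `λ` between `μ` and `s` (reversed)
is contained in `ν`. -/
theorem stmt12 (μ ν : Finset Box) (hμ : IsYoung μ) (hν : IsYoung ν) (hνne : ν.Nonempty)
    (s : Box) (hs1 : 1 ≤ s.1) (hs2 : 1 ≤ s.2) (hsm : (s.1 - 1, s.2 - 1) ∉ μ) :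
    polOrder (TM (star μ ν)) (brkN (s.1 - 1, s.2 - 1)) = 1 ↔
      ((s.1 - 1, s.2 - 1) ∉ ν ∧
        (((Outer μ ∩ Finset.Icc (0, 0) (s.1 - 1, s.2 - 1)).biUnion fun t =>
              Finset.Icc t (s.1 - 1, s.2 - 1)).image
            (fun c => (s.1 - 1 - c.1, s.2 - 1 - c.2))) ⊆ ν) := by
  rw [polOrder_eq_one_iff μ hμ ⟨ν, hν⟩ _ hsm, Finset.image_subset_iff]
  simp only [mem_biUnion_Outer_iff μ hμ, and_imp]
  rfl

end JackLR
end

section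
/- Let μ be any partition, let m,n ≥ 1, let σ := μ ∩ m^n (intersection of box sets, a partition), and let σ̄ be the complement of σ in m^n. Then, as an identity of rational functions in u over ℚ(α): T_{σ̄}([(m,n)] − u) = T_{μ∪m^n}(u) / T_{μ}(u), where the left-hand side denotes T_{σ̄} precomposed with the substitution u ↦ (αm − n) − u, and μ∪m^n is the union of the box sets of μ and m^n (a partition). -/
/-!
Common setup: boxes, Young diagrams as finite lower sets of boxes (French notation),
arms, legs, hooks, the field `ℚ(α)`, rational functions in `u` over `ℚ(α)`,
the functions `T_Γ`, corners, star products, rectangles and complements.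
-/

open scoped BigOperators

attribute [local instance] Classical.propDecidable

namespace JackLR

theorem uu_sub_C_ne_zero (c : K) : uu - RatFunc.C c ≠ 0 := by
  intro h
  have h' : algebraMap (Polynomial K) F (Polynomial.X - Polynomial.C c) = 0 := by
    rw [map_sub, RatFunc.algebraMap_X, RatFunc.algebraMap_C]
    exact h
  exact Polynomial.X_sub_C_ne_zero c ((map_eq_zero_iff _ (RatFunc.algebraMap_injective K)).mp h')

theorem Tbox_uu_sub_C_ne_zero (c : K) : Tbox (uu - RatFunc.C c) ≠ 0 := by
  have h (d : K) : uu - RatFunc.C c - RatFunc.C d ≠ 0 := by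
    rw [sub_sub, ← map_add]
    exact uu_sub_C_ne_zero _
  exact div_ne_zero (mul_ne_zero (h _) (h _)) (mul_ne_zero (h _) (h _))

theorem TS_eq_prod (S : Finset Box) : TS S = ∏ b ∈ S, Tbox (uu - RatFunc.C (brkN b)) := rfl

theorem TS_ne_zero (S : Finset Box) : TS S ≠ 0 := by
  rw [TS_eq_prod]
  exact Finset.prod_ne_zero_iff.mpr fun b _ => Tbox_uu_sub_C_ne_zero _

/-- The symmetry `T_□([(1,1)] − w) = T_□(w)`. -/
theorem Tbox_reflect (w : F) : Tbox (RatFunc.C (brk (1, 1)) - w) = Tbox w := by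
  have h : brk (1, 1) = brk (1, 0) + brk (0, 1) := by simp [brk, sub_eq_add_neg]
  have h0 : brk (0, 0) = 0 := by simp [brk]
  unfold Tbox
  rw [h, h0, map_add, map_zero]
  congr 1 <;> ring

theorem brk_sub_brkN_conjBox {m n : ℕ} {b : Box} (hb : b ∈ rect m n) :
    brk ((m : ℤ), (n : ℤ)) - brkN (conjBox m n b) = brk (1, 1) + brkN b := by
  obtain ⟨h1, h2⟩ := Finset.mem_product.mp hb
  rw [Finset.mem_range] at h1 h2
  have e1 : ((m - 1 - b.1 : ℕ) : ℤ) = m - 1 - b.1 := by omega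
  have e2 : ((n - 1 - b.2 : ℕ) : ℤ) = n - 1 - b.2 := by omega
  simp only [brkN, brk, zb, conjBox, e1, e2]
  push_cast
  ring

theorem conjBox_injOn (m n : ℕ) : Set.InjOn (conjBox m n) (rect m n : Set Box) := by
  rintro ⟨a, b⟩ hab ⟨c, d⟩ hcd h
  simp only [rect, Finset.coe_product, Set.mem_prod, Finset.coe_range, Set.mem_Iio] at hab hcd
  simp only [conjBox, Prod.mk.injEq] at h ⊢
  omega

/-- `T_{σ̄}([(m,n)] − u) = T_{μ∪m^n}(u) / T_μ(u)` where `σ = μ ∩ m^n`. -/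
theorem stmt14 (m n : ℕ) (hm : 1 ≤ m) (hn : 1 ≤ n) (μ : Finset Box) (hμ : IsYoung μ) :
    TMat (complIn m n (μ ∩ rect m n)).val (RatFunc.C (brk ((m : ℤ), (n : ℤ))) - uu) =
      TS (μ ∪ rect m n) / TS μ := by
  have hsdiff : rect m n \ (μ ∩ rect m n) = (μ ∪ rect m n) \ μ := by
    ext b
    simp only [Finset.mem_sdiff, Finset.mem_inter, Finset.mem_union]
    tauto
  rw [eq_div_iff (TS_ne_zero μ), TS_eq_prod (μ ∪ rect m n),
    ← Finset.prod_sdiff (Finset.subset_union_left : μ ⊆ μ ∪ rect m n), ← hsdiff, ← TS_eq_prod μ]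
  congr 1
  change ∏ b ∈ complIn m n (μ ∩ rect m n), Tbox (_ - RatFunc.C (brkN b)) = _
  rw [complIn, Finset.prod_image
    ((conjBox_injOn m n).mono (Finset.coe_subset.mpr Finset.sdiff_subset))]
  refine Finset.prod_congr rfl fun b hb => ?_
  rw [sub_right_comm, ← map_sub, brk_sub_brkN_conjBox (Finset.mem_sdiff.mp hb).1, map_add,
    add_sub_assoc, ← neg_sub uu, ← sub_eq_add_neg, Tbox_reflect]

end JackLR
end
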